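/- For n = 2 agents: (i) every v ∈ V(1/3; 3) satisfies MMS_2(v) ≤ 2/3, and there exists v ∈ V(1/3; 3) with MMS_2(v) = 2/3; (ii) for every real α with 1/4 ≤ α ≤ 1/3, every v ∈ V(α; 4) satisfies MMS_2(v) ≤ 2α, and there exists v ∈ V(α; 4) with MMS_2(v) = 2α. -/

import Mathlib

open Finset

/-- A (normalised, additive) disutility function on `m` objects. -/
def IsDisutility (m : ℕ) (v : Fin m → ℝ) : Prop :=
  (∀ e, 0 ≤ v e) ∧ ∑ e, v e = 1

/-- The MinMaxShare of `v` among `n` agents: the minimum over allocations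
`A : Fin m → Fin n` of the maximum bundle disutility. -/
noncomputable def MMS (n m : ℕ) (v : Fin m → ℝ) : ℝ :=
  ⨅ A : Fin m → Fin n, ⨆ j : Fin n, ∑ e ∈ Finset.univ.filter (fun e => A e = j), v e

/-- `v ∈ V(α;m)`: a disutility function on `m` objects whose maximum single-object
value equals `α`. -/
def Vmem (α : ℝ) (m : ℕ) (v : Fin m → ℝ) : Prop :=
  IsDisutility m v ∧ (⨆ e, v e) = α

/-- Any allocation bounds the MinMaxShare from above. -/
lemma MMS_le_of_allocation {n m : ℕ} [NeZero n] {v : Fin m → ℝ} {c : ℝ} (A : Fin m → Fin n)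
    (h : ∀ j, ∑ e ∈ Finset.univ.filter (fun e => A e = j), v e ≤ c) : MMS n m v ≤ c :=
  (ciInf_le (Set.finite_range _).bddBelow A).trans (ciSup_le h)

/-- If more than `n` objects have value at least `a`, then some agent receives two of them. -/
lemma two_mul_le_MMS {n m k : ℕ} [NeZero n] {v : Fin m → ℝ} {a : ℝ} (hv : ∀ e, 0 ≤ v e)
    (g : Fin k → Fin m) (hg : Function.Injective g) (hk : n < k) (ha : ∀ i, a ≤ v (g i)) :
    2 * a ≤ MMS n m v := by
  refine le_ciInf fun A => ?_
  obtain ⟨x, y, hxy, hA⟩ :=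
    Fintype.exists_ne_map_eq_of_card_lt (fun i => A (g i)) (by simpa using hk)
  refine le_trans ?_ (le_ciSup (f := fun j => ∑ e ∈ Finset.univ.filter (fun e => A e = j), v e)
    (Set.finite_range _).bddAbove (A (g x)))
  calc 2 * a ≤ v (g x) + v (g y) := by linarith [ha x, ha y]
    _ = ∑ e ∈ {g x, g y}, v e := (Finset.sum_pair (hg.ne hxy)).symm
    _ ≤ _ := by
      refine Finset.sum_le_sum_of_subset_of_nonneg (fun e he => ?_) fun e _ _ => hv e
      rcases Finset.mem_insert.1 he with rfl | he
      · simp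
      · rw [Finset.mem_singleton.1 he]
        simpa using hA.symm

lemma Vmem.le {α : ℝ} {m : ℕ} {v : Fin m → ℝ} (h : Vmem α m v) (e : Fin m) : v e ≤ α :=
  h.2 ▸ le_ciSup (Set.finite_range v).bddAbove e

lemma Vmem.of_le {α : ℝ} {m : ℕ} {v : Fin m → ℝ} (hv : IsDisutility m v) (hle : ∀ e, v e ≤ α)
    (e : Fin m) (he : v e = α) : Vmem α m v :=
  have : Nonempty (Fin m) := ⟨e⟩
  ⟨hv, le_antisymm (ciSup_le hle) (he ▸ le_ciSup (Set.finite_range v).bddAbove e)⟩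

lemma MMS_two_three_le {α : ℝ} (hα : 0 ≤ α) {v : Fin 3 → ℝ} (h : Vmem α 3 v) :
    MMS 2 3 v ≤ 2 * α := by
  have h0 := h.le 0
  have h1 := h.le 1
  have h2 := h.le 2
  refine MMS_le_of_allocation ![0, 0, 1] fun j => ?_
  fin_cases j <;> simp [Finset.sum_filter, Fin.sum_univ_succ] <;> linarith

lemma MMS_two_four_le {α : ℝ} {v : Fin 4 → ℝ} (h : Vmem α 4 v) : MMS 2 4 v ≤ 2 * α := by
  have h0 := h.le 0
  have h1 := h.le 1
  have h2 := h.le 2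
  have h3 := h.le 3
  refine MMS_le_of_allocation ![0, 0, 1, 1] fun j => ?_
  fin_cases j <;> simp [Finset.sum_filter, Fin.sum_univ_four] <;> linarith

theorem stmt9 :
    ((∀ v : Fin 3 → ℝ, Vmem (1/3) 3 v → MMS 2 3 v ≤ 2/3) ∧
     (∃ v : Fin 3 → ℝ, Vmem (1/3) 3 v ∧ MMS 2 3 v = 2/3)) ∧
    (∀ α : ℝ, 1/4 ≤ α → α ≤ 1/3 →
      (∀ v : Fin 4 → ℝ, Vmem α 4 v → MMS 2 4 v ≤ 2*α) ∧
      (∃ v : Fin 4 → ℝ, Vmem α 4 v ∧ MMS 2 4 v = 2*α)) := by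
  have upper : ∀ v : Fin 3 → ℝ, Vmem (1/3) 3 v → MMS 2 3 v ≤ 2/3 := fun v hv =>
    (MMS_two_three_le (by norm_num) hv).trans_eq (by norm_num)
  refine ⟨⟨upper, ?_⟩, fun α h4 h3 => ⟨fun v => MMS_two_four_le, ?_⟩⟩
  · have hv : Vmem (1/3) 3 (fun _ => (1/3 : ℝ)) :=
      Vmem.of_le ⟨fun _ => by norm_num, by simp⟩ (fun _ => le_rfl) 0 rfl
    refine ⟨_, hv, le_antisymm (upper _ hv) ?_⟩
    have := two_mul_le_MMS (n := 2) hv.1.1 id Function.injective_id (by norm_num) fun _ => le_rfl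
    linarith
  · have hv : Vmem α 4 ![α, α, α, 1 - 3 * α] := by
      refine Vmem.of_le ⟨fun e => ?_, ?_⟩ (fun e => ?_) 0 rfl
      · fin_cases e <;> simp <;> linarith
      · simp [Fin.sum_univ_four]
        ring
      · fin_cases e <;> simp
        linarith
    refine ⟨_, hv, le_antisymm (MMS_two_four_le hv) ?_⟩
    refine two_mul_le_MMS hv.1.1 (Fin.castSucc : Fin 3 → Fin 4) (Fin.castSucc_injective 3)
      (by norm_num) fun i => ?_
    fin_cases i <;> simp
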